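/- For every pair of integers m and n with m - 2 ≥ n ≥ 10, there exists a position on the m-by-n Phutball board that is drawn: both players have drawing strategies from it. -/

import Mathlib

/-!
Formalization of Philosophers' Phutball on an `m × n` board (`m` rows, `n` columns).
Points are pairs `(column, row)` of integers, with columns `1, …, n` (a, b, c, …)
and rows `1, …, m` (bottom to top).  Player `true` is Alfred (first player, aims
for the top row `m`); player `false` is Betty (aims for the bottom row `1`).
-/

/-- A player: `true` is Alfred, `false` is Betty. -/
abbrev Player := Bool

/-- A Phutball position: the ball's point `(column, row)`, the finite set of
chaps, and the player whose turn it is. -/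
structure PState where
  ball : ℤ × ℤ
  chaps : Finset (ℤ × ℤ)
  turn : Player
deriving DecidableEq

/-- The eight horizontal, vertical and diagonal directions. -/
def dirs : Finset (ℤ × ℤ) :=
  {(1, 0), (1, 1), (0, 1), (-1, 1), (-1, 0), (-1, -1), (0, -1), (1, -1)}

/-- The point reached from `b` after `i` steps in direction `d`. -/
def ray (b d : ℤ × ℤ) (i : ℤ) : ℤ × ℤ := (b.1 + i * d.1, b.2 + i * d.2)

/-- A point is on the `m × n` board. -/
def OnBoard (m n : ℤ) (p : ℤ × ℤ) : Prop :=
  1 ≤ p.1 ∧ p.1 ≤ n ∧ 1 ≤ p.2 ∧ p.2 ≤ m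

/-- A single hop on a board with `n` columns: the ball at `b` moves in one of the
eight directions `d` over a contiguous nonempty line of `k` chaps, landing on the
first point beyond them that carries no chap; the jumped-over chaps are removed.
The landing point must not lie onto or past the sidelines (outside columns
`1, …, n`), but it may lie past the top or bottom row. -/
def Hop (n : ℤ) (b : ℤ × ℤ) (c : Finset (ℤ × ℤ)) (b' : ℤ × ℤ) (c' : Finset (ℤ × ℤ)) : Prop :=
  ∃ d ∈ dirs, ∃ k : ℕ, 1 ≤ k ∧
    (∀ i : ℕ, 1 ≤ i → i ≤ k → ray b d i ∈ c) ∧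
    ray b d (k + 1) ∉ c ∧
    1 ≤ (ray b d (k + 1)).1 ∧ (ray b d (k + 1)).1 ≤ n ∧
    b' = ray b d (k + 1) ∧
    c' = c \ Finset.image (fun i : ℕ => ray b d i) (Finset.Icc 1 k)

/-- A jump is a nonempty sequence of hops (the player may stop after any hop,
and the removed chaps cannot be re-used by later hops of the same jump).  The
jump can continue after a hop only if the ball has not been carried past the top
or bottom row (which would end the game immediately). -/
inductive Jump (m n : ℤ) : ℤ × ℤ → Finset (ℤ × ℤ) → ℤ × ℤ → Finset (ℤ × ℤ) → Prop
  | single {b c b' c'} : Hop n b c b' c' → Jump m n b c b' c'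
  | cons {b c b₁ c₁ b' c'} : Hop n b c b₁ c₁ → 1 ≤ b₁.2 → b₁.2 ≤ m →
      Jump m n b₁ c₁ b' c' → Jump m n b c b' c'

/-- The winner, if any, of a position (evaluated between turns): Alfred wins if
the ball rests on the top row `m` or has been carried past it; Betty wins if the
ball rests on the bottom row `1` or has been carried past it. -/
def winner (m : ℤ) (s : PState) : Option Player :=
  if m ≤ s.ball.2 then some true else if s.ball.2 ≤ 1 then some false else none

/-- A single legal move on the `m × n` board: the player to move either places a
chap on a vacant on-board point, or moves the ball by a jump; the turn passes to
the other player. -/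
def MoveRel (m n : ℤ) (s t : PState) : Prop :=
  t.turn = !s.turn ∧
    ((∃ p, OnBoard m n p ∧ p ∉ s.chaps ∧ p ≠ s.ball ∧
        t.ball = s.ball ∧ t.chaps = insert p s.chaps) ∨
      Jump m n s.ball s.chaps t.ball t.chaps)

/-- An infinite record of play: while the game is not over and a legal move
exists, a legal move is made; otherwise the position is frozen forever. -/
def IsPlay (m n : ℤ) (f : ℕ → PState) : Prop :=
  ∀ k,
    (winner m (f k) = none ∧ (∃ t, MoveRel m n (f k) t) ∧ MoveRel m n (f k) (f (k + 1))) ∨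
    ((winner m (f k) ≠ none ∨ ¬ ∃ t, MoveRel m n (f k) t) ∧ f (k + 1) = f k)

/-- A strategy for player `p` that always proposes a legal move whenever the game
is not over, it is `p`'s turn, and some legal move exists. -/
def LegalStrategy (m n : ℤ) (p : Player) (σ : PState → PState) : Prop :=
  ∀ s, s.turn = p → winner m s = none → (∃ t, MoveRel m n s t) → MoveRel m n s (σ s)

/-- The play `f` follows the strategy `σ` of player `p`. -/
def Follows (m n : ℤ) (p : Player) (σ : PState → PState) (f : ℕ → PState) : Prop :=
  ∀ k, (f k).turn = p → winner m (f k) = none → (∃ t, MoveRel m n (f k) t) →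
    f (k + 1) = σ (f k)

/-- Player `p` has a winning strategy from `s₀` on the `m × n` board: a legal
strategy guaranteeing that, against every play of the opponent, `p` wins after
finitely many moves. -/
def WinsFrom (m n : ℤ) (p : Player) (s₀ : PState) : Prop :=
  ∃ σ, LegalStrategy m n p σ ∧
    ∀ f, IsPlay m n f → f 0 = s₀ → Follows m n p σ f → ∃ k, winner m (f k) = some p

/-- Player `p` has a drawing strategy from `s₀` on the `m × n` board: a legal
strategy guaranteeing that the opponent never wins (play may continue forever). -/
def DrawsFrom (m n : ℤ) (p : Player) (s₀ : PState) : Prop :=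
  ∃ σ, LegalStrategy m n p σ ∧
    ∀ f, IsPlay m n f → f 0 = s₀ → Follows m n p σ f → ∀ k, winner m (f k) ≠ some (!p)

/-- A position is drawn if both players have drawing strategies from it. -/
def Drawn (m n : ℤ) (s : PState) : Prop :=
  DrawsFrom m n true s ∧ DrawsFrom m n false s

/-- A configuration of the `3 × 7` window: the window coordinates `(x, y)` of the ball, with
`1 ≤ x ≤ 3` and `1 ≤ y ≤ 7`, and the set of chaps of the window, encoded in binary: the point
`(a, b)` corresponds to the bit `3 * b + a`. -/
abbrev Cfg := ℕ × ℕ × ℕ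

/-- Membership of a point in the window. -/
def inWin (x y : ℕ) : Bool := Nat.ble 1 x && Nat.ble x 3 && Nat.ble 1 y && Nat.ble y 7

/-- Whether the `i`-th binary digit of `c` is `1`. -/
def hasBit (c i : ℕ) : Bool := Nat.beq (Nat.land (Nat.shiftRight c i) 1) 1

/-- Replace the `i`-th binary digit of `c` by `1`. -/
def setBit (c i : ℕ) : ℕ := Nat.lor c (Nat.pow 2 i)

/-- The directions, with both coordinates increased by one. -/
def dirCodes : List (ℕ × ℕ) :=
  [(1, 2), (0, 2), (2, 2), (2, 1), (0, 1), (0, 0), (2, 0), (1, 0)]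

/-- One coordinate of the `i`-th point of a ray starting at `x` in the direction coded by `e`. -/
def step (x e i : ℕ) : ℕ := Nat.sub (Nat.add x (Nat.mul i e)) i

/-- Index of the bit of the `i`-th point of a ray. -/
def rayBit (e f x y i : ℕ) : ℕ := Nat.add (Nat.mul 3 (step y f i)) (step x e i)

/-- Whether the `i`-th point of a ray carries a chap of the window. -/
def chapAt (e f x y c i : ℕ) : Bool :=
  inWin (step x e i) (step y f i) && hasBit c (rayBit e f x y i)

/-- The first index `j ≥ i` such that the `j`-th point of the ray carries no chap of the window,
searched among `k` consecutive values. -/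
def firstFree (e f x y c : ℕ) : ℕ → ℕ → ℕ
  | 0, i => i
  | k + 1, i => bif chapAt e f x y c i then firstFree e f x y c k (Nat.succ i) else i

/-- Remove the chaps at the first `k` points of a ray. -/
def eraseRay (e f x y c : ℕ) : ℕ → ℕ
  | 0 => c
  | k + 1 =>
    Nat.xor (setBit (eraseRay e f x y c k) (rayBit e f x y (k + 1)))
      (Nat.pow 2 (rayBit e f x y (k + 1)))

/-- Whether a hop leaving the window in the given direction might win the game for player `p`. -/
def mayExit (p : Player) (e f x y : ℕ) : Bool :=
  bif p then
    Nat.beq f 2 && (Nat.beq e 1 || (Nat.beq e 2 && Nat.ble (Nat.add x 4) y) ||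
      (Nat.beq e 0 && Nat.ble 8 (Nat.add x y)))
  else
    Nat.beq f 0 && (Nat.beq e 1 || (Nat.beq e 2 && Nat.ble (Nat.add x y) 4) ||
      (Nat.beq e 0 && Nat.ble y (Nat.add x 1)))

/-- No jump of the opponent of `p` of at most `k` hops wins, and all of them lead to
configurations satisfying `K`. -/
def jumpsSafe (p : Player) (K : Cfg → Bool) : ℕ → Cfg → Bool
  | 0, _ => false
  | k + 1, (x, y, c) => dirCodes.all fun (e, f) =>
    let j := firstFree e f x y c 8 1
    bif inWin (step x e j) (step y f j) then
      Nat.beq j 1 || (K (step x e j, step y f j, eraseRay e f x y c (Nat.pred j)) &&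
        jumpsSafe p K k (step x e j, step y f j, eraseRay e f x y c (Nat.pred j)))
    else !mayExit (!p) e f x y

/-- The points of the window. -/
def cells : List (ℕ × ℕ) := [1, 2, 3].product [1, 2, 3, 4, 5, 6, 7]

/-- All moves of the opponent of `p` are harmless and lead to configurations satisfying `K`. -/
def movesSafe (p : Player) (K : Cfg → Bool) (s : Cfg) : Bool :=
  jumpsSafe p K 12 s && cells.all fun (a, b) =>
    hasBit s.2.2 (Nat.add (Nat.mul 3 b) a) || (Nat.beq a s.1 && Nat.beq b s.2.1) ||
      K (s.1, s.2.1, setBit s.2.2 (Nat.add (Nat.mul 3 b) a))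

/-- Player `p` has a jump of at most `k` hops carrying the ball past the goalline. -/
def winJump (p : Player) : ℕ → Cfg → Bool
  | 0, _ => false
  | k + 1, (x, y, c) => (bif p then dirCodes else dirCodes.reverse).any fun (e, f) =>
    let j := firstFree e f x y c 8 1
    bif inWin (step x e j) (step y f j) then
      !Nat.beq j 1 && winJump p k (step x e j, step y f j, eraseRay e f x y c (Nat.pred j))
    else Nat.beq e 1 && Nat.beq f (bif p then 2 else 0)

/-- Equality of configurations. -/
def sameCfg (s t : Cfg) : Bool := Nat.beq s.2.2 t.2.2 && Nat.beq s.1 t.1 && Nat.beq s.2.1 t.2.1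

/-- There is a jump of at most `k` hops from a configuration to the configuration `t`. -/
def canJump (t : Cfg) : ℕ → Cfg → Bool
  | 0, _ => false
  | k + 1, (x, y, c) => dirCodes.any fun (e, f) =>
    let j := firstFree e f x y c 8 1
    inWin (step x e j) (step y f j) && !Nat.beq j 1 &&
      (sameCfg t (step x e j, step y f j, eraseRay e f x y c (Nat.pred j)) ||
        canJump t k (step x e j, step y f j, eraseRay e f x y c (Nat.pred j)))

/-- There is a placement leading from `s` to `t`. -/
def canPlace (s t : Cfg) : Bool := cells.any fun (a, b) =>
  !hasBit s.2.2 (Nat.add (Nat.mul 3 b) a) && !(Nat.beq a s.1 && Nat.beq b s.2.1) &&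
    sameCfg t (s.1, s.2.1, setBit s.2.2 (Nat.add (Nat.mul 3 b) a))

/-- Player `p`, to move, either wins at once or finds a reply in the list `L`. -/
def known (p : Player) (L : List (Cfg × Cfg)) (s : Cfg) : Bool :=
  winJump p 12 s || L.any fun r => sameCfg s r.1

/-- The list `L` of configurations and replies is a drawing strategy for `p`. -/
def closed (p : Player) (L : List (Cfg × Cfg)) : Bool :=
  L.all fun r => inWin r.2.1 r.2.2.1 && (canPlace r.1 r.2 || canJump r.2 12 r.1) &&
    movesSafe p (known p L) r.2

/-- Configurations with Alfred to move, each paired with the reply of his drawing strategy. -/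
def alfredReplies : List (Cfg × Cfg) := [
  ((1, 3, 17305616), (1, 3, 17313808)), ((1, 3, 18649104), (1, 3, 18657296)),
  ((1, 3, 19009552), (1, 3, 19017744)), ((1, 3, 19083280), (1, 3, 19607568)),
  ((1, 3, 19279888), (1, 3, 19804176)), ((1, 4, 16842768), (1, 4, 21037072)),
  ((1, 4, 16846864), (1, 4, 17371152)), ((1, 4, 17039376), (1, 4, 17170448)),
  ((1, 4, 18350096), (1, 4, 18415632)), ((1, 4, 19267600), (1, 4, 19333136)),
  ((1, 4, 19365904), (1, 4, 19890192)), ((1, 4, 20971568), (1, 4, 21037104)),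
  ((1, 4, 20971600), (1, 4, 21037136)), ((1, 4, 20971664), (1, 4, 21037200)),
  ((1, 4, 20971792), (1, 4, 21037328)), ((1, 4, 21024784), (1, 4, 21090320)),
  ((1, 4, 21495824), (1, 4, 21561360)), ((1, 4, 21495952), (1, 4, 21561488)),
  ((1, 4, 21499920), (1, 4, 21565456)), ((1, 4, 25493520), (1, 4, 29687824)),
  ((1, 5, 16781328), (1, 5, 17305616)), ((1, 5, 17862672), (1, 5, 18124816)),
  ((1, 5, 18124848), (1, 5, 18649136)), ((1, 5, 18124880), (1, 5, 18649168)),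
  ((1, 5, 18124944), (1, 5, 18649232)), ((1, 5, 18125072), (1, 5, 18649360)),
  ((1, 5, 18125328), (1, 5, 18649616)), ((1, 5, 18125840), (1, 5, 18650128)),
  ((1, 5, 18126864), (1, 5, 18651152)), ((1, 5, 18133008), (1, 5, 18657296)),
  ((1, 5, 18141200), (1, 5, 18665488)), ((1, 5, 18255888), (1, 5, 18780176)),
  ((1, 5, 18878544), (1, 5, 19402832)), ((1, 5, 18878608), (1, 5, 19402896)),
  ((1, 5, 18878736), (1, 5, 19403024)), ((1, 5, 18878992), (1, 5, 19403280)),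
  ((1, 5, 18880528), (1, 5, 19404816)), ((1, 5, 18894864), (1, 5, 19419152)),
  ((1, 5, 20221968), (1, 5, 20746256)), ((1, 5, 22319120), (1, 5, 22843408)),
  ((1, 5, 23068688), (1, 5, 23592976)), ((1, 5, 24154128), (1, 5, 24678416)),
  ((1, 5, 26513424), (1, 5, 27037712)), ((1, 5, 27267088), (1, 5, 27791376)),
  ((1, 6, 16777232), (1, 6, 16777296)), ((1, 6, 16777328), (1, 6, 20971632)),
  ((1, 6, 16777392), (1, 6, 20971696)), ((1, 6, 16777424), (1, 6, 20971728)),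
  ((1, 6, 16777520), (1, 6, 20971824)), ((1, 6, 16777552), (1, 6, 20971856)),
  ((1, 6, 16777616), (1, 6, 20971920)), ((1, 6, 16777776), (1, 6, 20972080)),
  ((1, 6, 16777808), (1, 6, 20972112)), ((1, 6, 16778000), (1, 6, 20972304)),
  ((1, 6, 16778288), (1, 6, 20972592)), ((1, 6, 16778320), (1, 6, 20972624)),
  ((1, 6, 16778512), (1, 6, 20972816)), ((1, 6, 16779312), (1, 6, 20973616)),
  ((1, 6, 16779344), (1, 6, 20973648)), ((1, 6, 16779536), (1, 6, 20973840)),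
  ((1, 6, 16781328), (1, 6, 16797712)), ((1, 6, 16781360), (1, 6, 20975664)),
  ((1, 6, 16781392), (1, 6, 20975696)), ((1, 6, 16781584), (1, 6, 20975888)),
  ((1, 6, 16785456), (1, 6, 20979760)), ((1, 6, 16785488), (1, 6, 20979792)),
  ((1, 6, 16785680), (1, 6, 20979984)), ((1, 6, 16793648), (1, 6, 20987952)),
  ((1, 6, 16793680), (1, 6, 20987984)), ((1, 6, 16793872), (1, 6, 20988176)),
  ((1, 6, 16797744), (1, 6, 20992048)), ((1, 6, 16797776), (1, 6, 20992080)),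
  ((1, 6, 16797840), (1, 6, 20992144)), ((1, 6, 16797968), (1, 6, 20992272)),
  ((1, 6, 16798224), (1, 6, 20992528)), ((1, 6, 16798736), (1, 6, 20993040)),
  ((1, 6, 16799760), (1, 6, 20994064)), ((1, 6, 16805904), (1, 6, 21000208)),
  ((1, 6, 16810032), (1, 6, 21004336)), ((1, 6, 16810064), (1, 6, 21004368)),
  ((1, 6, 16810256), (1, 6, 21004560)), ((1, 6, 16830480), (1, 6, 21024784)),
  ((1, 6, 16830512), (1, 6, 21024816)), ((1, 6, 16830544), (1, 6, 21024848)),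
  ((1, 6, 16830608), (1, 6, 21024912)), ((1, 6, 16830736), (1, 6, 21025040)),
  ((1, 6, 16830992), (1, 6, 21025296)), ((1, 6, 16831504), (1, 6, 21025808)),
  ((1, 6, 16832528), (1, 6, 21026832)), ((1, 6, 16838672), (1, 6, 21032976)),
  ((1, 6, 16842800), (1, 6, 21037104)), ((1, 6, 16842832), (1, 6, 21037136)),
  ((1, 6, 16843024), (1, 6, 21037328)), ((1, 6, 16863248), (1, 6, 16994320)),
  ((1, 6, 16896016), (1, 6, 21090320)), ((1, 6, 16908336), (1, 6, 17170480)),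
  ((1, 6, 16908368), (1, 6, 17170512)), ((1, 6, 16908560), (1, 6, 21102864)),
  ((1, 6, 16928784), (1, 6, 16994320)), ((1, 6, 16961552), (1, 6, 21155856)),
  ((1, 6, 17002512), (3, 5, 16912400)), ((1, 6, 17039408), (1, 6, 21233712)),
  ((1, 6, 17039440), (1, 6, 21233744)), ((1, 6, 17039632), (1, 6, 21233936)),
  ((1, 6, 17047568), (1, 6, 21241872)), ((1, 6, 17059856), (1, 6, 21254160)),
  ((1, 6, 17092624), (1, 6, 21286928)), ((1, 6, 17104912), (1, 6, 17235984)),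
  ((1, 6, 17203248), (1, 6, 21397552)), ((1, 6, 17203280), (1, 6, 21397584)),
  ((1, 6, 18874416), (1, 6, 23068720)), ((1, 6, 18874448), (1, 6, 23068752)),
  ((1, 6, 18874640), (1, 6, 23068944)), ((1, 6, 18894864), (1, 6, 23089168)),
  ((1, 6, 18927632), (1, 6, 23121936)), ((1, 6, 19091472), (1, 6, 23285776)),
  ((1, 6, 25165872), (1, 6, 29360176)), ((1, 6, 25165904), (1, 6, 29360208)),
  ((1, 6, 25166096), (1, 6, 29360400)), ((1, 6, 25186320), (1, 6, 29380624)),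
  ((1, 6, 25219088), (1, 6, 29413392)), ((1, 6, 25427984), (1, 6, 29622288)),
  ((3, 2, 16859152), (3, 2, 16863248)), ((3, 2, 16863280), (1, 6, 16777264)),
  ((3, 2, 16863312), (1, 6, 16777296)), ((3, 2, 16863376), (3, 2, 17387664)),
  ((3, 2, 16863504), (1, 6, 16777488)), ((3, 2, 16864272), (3, 2, 16897040)),
  ((3, 2, 16865296), (1, 6, 16797712)), ((3, 2, 16871440), (3, 2, 17133584)),
  ((3, 2, 16896016), (3, 2, 17158160)), ((3, 2, 16897072), (3, 5, 16860208)),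
  ((3, 2, 16897104), (3, 5, 16860240)), ((3, 2, 16897168), (3, 2, 17159312)),
  ((3, 2, 16897296), (1, 6, 16830480)), ((3, 2, 16899088), (3, 5, 16862224)),
  ((3, 2, 16905232), (3, 2, 19002384)), ((3, 2, 16908304), (3, 2, 16912400)),
  ((3, 2, 16912432), (1, 6, 16777264)), ((3, 2, 16912464), (1, 6, 16777296)),
  ((3, 2, 16912528), (3, 2, 21106832)), ((3, 2, 16912656), (1, 6, 16777488)),
  ((3, 2, 16913424), (3, 2, 21107728)), ((3, 2, 16920592), (3, 2, 17182736)),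
  ((3, 2, 16945168), (3, 2, 17469456)), ((3, 2, 16977936), (3, 2, 17240080)),
  ((3, 2, 17028112), (3, 2, 19125264)), ((3, 2, 17383440), (3, 2, 17387536)),
  ((3, 2, 17395728), (3, 2, 17657872)), ((3, 2, 17395856), (3, 2, 17658000)),
  ((3, 2, 17420304), (3, 2, 17682448)), ((3, 2, 17420432), (3, 2, 17682576)),
  ((3, 2, 17421328), (3, 2, 17683472)), ((3, 2, 17436688), (3, 2, 17469456)),
  ((3, 2, 17534992), (3, 2, 17797136)), ((3, 2, 17653776), (3, 2, 17657872)),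
  ((3, 2, 17956880), (3, 2, 17960976)), ((3, 2, 18485264), (3, 2, 18747408)),
  ((3, 2, 18960400), (3, 2, 23154704)), ((3, 2, 19009552), (3, 2, 23203856)),
  ((3, 2, 20058128), (3, 2, 24252432)), ((3, 2, 21091344), (3, 2, 21353488)),
  ((3, 2, 21102608), (3, 2, 21106704)), ((3, 2, 21139472), (3, 2, 23236624)),
  ((3, 2, 21139600), (3, 2, 21401744)), ((3, 2, 21140496), (3, 2, 21664784)),
  ((3, 2, 21630992), (3, 2, 21893136)), ((3, 2, 21631120), (3, 2, 21893264)),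
  ((3, 2, 21632016), (3, 2, 21664784)), ((3, 2, 21730320), (3, 2, 23827472)),
  ((3, 2, 21889040), (3, 2, 21893136)), ((3, 2, 23150608), (3, 2, 23154704)),
  ((3, 2, 23162896), (3, 2, 23195664)), ((3, 2, 23199760), (3, 2, 23203856)),
  ((3, 2, 23728144), (3, 2, 23760912)), ((3, 2, 24248336), (3, 2, 24252432)),
  ((3, 2, 24776720), (3, 2, 24809488)), ((3, 2, 25251856), (3, 2, 25514000)),
  ((3, 2, 25285648), (3, 2, 25547792)), ((3, 2, 25301008), (3, 2, 29495312)),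
  ((3, 2, 29528080), (3, 2, 30052368)), ((3, 2, 30019600), (3, 2, 30052368)),
  ((3, 2, 30117904), (3, 2, 30380048)), ((3, 3, 18957360), (3, 3, 18990128)),
  ((3, 3, 18957392), (3, 3, 18990160)), ((3, 3, 18959376), (3, 3, 18992144)),
  ((3, 4, 16777232), (3, 4, 17039376)), ((3, 4, 16859152), (3, 4, 21053456)),
  ((3, 4, 16863248), (3, 4, 17387536)), ((3, 4, 16874512), (1, 6, 16797712)),
  ((3, 4, 16908304), (3, 4, 21102608)), ((3, 4, 16912400), (3, 4, 21106704)),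
  ((3, 4, 17395728), (3, 4, 17657872)), ((3, 4, 20971792), (3, 4, 21233936)),
  ((3, 4, 21061648), (3, 4, 21323792)), ((3, 4, 21626896), (3, 4, 21889040)),
  ((3, 4, 21630992), (3, 4, 21893136)), ((3, 5, 16777232), (3, 5, 18874384)),
  ((3, 5, 16860176), (3, 5, 16860240)), ((3, 5, 16860272), (3, 5, 18957424)),
  ((3, 5, 16860336), (3, 5, 18957488)), ((3, 5, 16860368), (3, 5, 18957520)),
  ((3, 5, 16860464), (3, 5, 18957616)), ((3, 5, 16860496), (3, 5, 18957648)),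
  ((3, 5, 16860720), (3, 5, 18957872)), ((3, 5, 16860752), (3, 5, 18957904)),
  ((3, 5, 16862256), (3, 5, 18959408)), ((3, 5, 16862288), (3, 5, 18959440)),
  ((3, 5, 16862352), (3, 5, 18959504)), ((3, 5, 16862480), (3, 5, 18959632)),
  ((3, 5, 16862736), (3, 5, 18959888)), ((3, 5, 16864304), (3, 5, 18961456)),
  ((3, 5, 16864336), (3, 5, 18961488)), ((3, 5, 16866320), (3, 5, 18963472)),
  ((3, 5, 16868400), (3, 5, 18965552)), ((3, 5, 16868432), (3, 5, 18965584)),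
  ((3, 5, 16870416), (3, 5, 18967568)), ((3, 5, 16892976), (3, 5, 18990128)),
  ((3, 5, 16893008), (3, 5, 18990160)), ((3, 5, 16894992), (3, 5, 18992144)),
  ((3, 5, 16912432), (3, 5, 17436720)), ((3, 5, 16912464), (3, 5, 19009616)),
  ((3, 5, 16912528), (3, 5, 19009680)), ((3, 5, 16912656), (3, 5, 19009808)),
  ((3, 5, 16912912), (3, 5, 19010064)), ((3, 5, 16913424), (3, 5, 17437712)),
  ((3, 5, 16914448), (3, 5, 19011600)), ((3, 5, 16920592), (3, 5, 17444880)),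
  ((3, 5, 16928784), (3, 5, 19025936)), ((3, 5, 16945168), (3, 5, 17993744)),
  ((3, 5, 16977936), (3, 5, 19075088)), ((3, 5, 16991280), (3, 5, 19088432)),
  ((3, 5, 16991312), (3, 5, 19088464)), ((3, 5, 16993296), (3, 5, 19090448)),
  ((3, 5, 17384496), (3, 5, 19481648)), ((3, 5, 17384528), (3, 5, 19481680)),
  ((3, 5, 17386512), (3, 5, 19483664)), ((3, 5, 17502256), (3, 5, 19599408)),
  ((3, 5, 17503248), (3, 5, 19600400)), ((3, 5, 17510416), (3, 5, 19607568)),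
  ((3, 5, 21054512), (3, 5, 23151664)), ((3, 5, 21054544), (3, 5, 23151696)),
  ((3, 5, 21056528), (3, 5, 23153680)), ((3, 5, 21106704), (3, 5, 21630992)),
  ((3, 5, 21696528), (3, 5, 23793680)), ((3, 5, 22188048), (3, 5, 24285200)),
  ((3, 5, 25248816), (3, 5, 27345968)), ((3, 5, 25248848), (3, 5, 27346000)),
  ((3, 5, 25250832), (3, 5, 27347984)), ((3, 5, 25301008), (3, 5, 27398160))]

/-- Configurations with Betty to move, each paired with the reply of her drawing strategy. -/
def bettyReplies : List (Cfg × Cfg) := [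
  ((1, 3, 16777232), (1, 3, 16777360)), ((1, 3, 16843280), (1, 3, 16843408)),
  ((1, 3, 16844848), (1, 3, 16845360)), ((1, 3, 16844880), (1, 3, 16845392)),
  ((1, 3, 16848912), (1, 3, 16849040)), ((1, 3, 16849456), (1, 3, 16849584)),
  ((1, 3, 16849488), (1, 3, 16849616)), ((1, 3, 16853008), (1, 3, 16853264)),
  ((1, 3, 16853328), (1, 3, 16853456)), ((1, 3, 16861200), (1, 3, 16861712)),
  ((1, 3, 16865808), (1, 3, 16898576)), ((1, 3, 16877584), (1, 3, 16878096)),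
  ((1, 3, 16882192), (1, 3, 16898576)), ((1, 3, 16975888), (1, 3, 16976400)),
  ((1, 3, 16980496), (1, 3, 16980624)), ((1, 3, 17059856), (1, 3, 17059984)),
  ((1, 3, 17106960), (1, 3, 17107088)), ((1, 3, 17160720), (1, 3, 17160848)),
  ((1, 3, 17190960), (1, 3, 17191088)), ((1, 3, 17190992), (1, 3, 17191120)),
  ((1, 3, 17191440), (1, 3, 17191568)), ((1, 3, 17192976), (1, 3, 17193104)),
  ((1, 3, 17199120), (1, 3, 17199248)), ((1, 3, 17223696), (1, 3, 17223824)),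
  ((1, 3, 17256464), (1, 3, 17256592)), ((1, 3, 17369104), (1, 3, 17369616)),
  ((1, 3, 17373712), (1, 3, 17373840)), ((1, 3, 17715216), (1, 3, 17715344)),
  ((1, 3, 17893392), (1, 3, 17893904)), ((1, 3, 17898000), (1, 3, 17898128)),
  ((1, 3, 18239504), (1, 3, 18239632)), ((1, 3, 18941968), (1, 3, 18942096)),
  ((1, 3, 19288080), (1, 3, 19288208)), ((1, 3, 21039120), (1, 3, 21039632)),
  ((1, 3, 21043728), (1, 3, 21043856)), ((1, 3, 21254192), (1, 3, 21254320)),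
  ((1, 3, 21254224), (1, 3, 21254352)), ((1, 3, 21254672), (1, 3, 21254800)),
  ((1, 3, 21256208), (1, 3, 21256336)), ((1, 3, 21262352), (1, 3, 21262480)),
  ((1, 3, 21286928), (1, 3, 21287056)), ((1, 3, 21319696), (1, 3, 21319824)),
  ((1, 3, 21385232), (1, 3, 21385360)), ((1, 3, 21778448), (1, 3, 21778576)),
  ((1, 3, 22302736), (1, 3, 22302864)), ((1, 3, 23351312), (1, 3, 23351440)),
  ((1, 3, 25233424), (1, 3, 25233936)), ((1, 3, 25238032), (1, 3, 25238160)),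
  ((1, 3, 25448496), (1, 3, 25448624)), ((1, 3, 25448528), (1, 3, 25448656)),
  ((1, 3, 25448976), (1, 3, 25449104)), ((1, 3, 25450512), (1, 3, 25450640)),
  ((1, 3, 25456656), (1, 3, 25456784)), ((1, 3, 25481232), (1, 3, 25481360)),
  ((1, 3, 25514000), (1, 3, 25514128)), ((1, 3, 25579536), (1, 3, 25579664)),
  ((1, 3, 25972752), (1, 3, 25972880)), ((1, 3, 26497040), (1, 3, 26497168)),
  ((1, 3, 27545616), (1, 3, 27545744)), ((1, 3, 29642768), (1, 3, 29642896)),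
  ((1, 4, 16777232), (1, 4, 16778256)), ((1, 4, 16779280), (1, 4, 16779344)),
  ((1, 4, 16779856), (1, 4, 16780880)), ((1, 4, 16797712), (1, 4, 16797776)),
  ((1, 4, 16830544), (1, 4, 16831568)), ((1, 4, 16844816), (1, 4, 16844880)),
  ((1, 4, 16845392), (1, 4, 16846416)), ((1, 4, 16863248), (1, 4, 16863760)),
  ((1, 4, 16896528), (1, 4, 16897552)), ((1, 4, 17825872), (1, 4, 17826896)),
  ((1, 5, 17191056), (1, 5, 17199248)), ((1, 5, 21254288), (1, 5, 21262480)),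
  ((1, 5, 25448592), (1, 5, 25456784)), ((1, 6, 16779280), (1, 6, 16844816)),
  ((1, 6, 16779344), (1, 6, 16844880)), ((1, 6, 16779472), (1, 6, 16845008)),
  ((1, 6, 16779536), (1, 6, 16845072)), ((1, 6, 16779728), (1, 6, 16845264)),
  ((1, 6, 16780880), (1, 6, 16846416)), ((1, 6, 16794640), (1, 6, 16860176)),
  ((1, 6, 16797712), (1, 6, 16863248)), ((1, 6, 16797904), (1, 6, 16863440)),
  ((1, 6, 16798224), (1, 6, 16863760)), ((1, 6, 16832016), (1, 6, 16897552)),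
  ((1, 6, 16844848), (1, 6, 16844912)), ((1, 6, 16844944), (1, 6, 16845008)),
  ((1, 6, 16845200), (1, 6, 16845264)), ((1, 6, 16845328), (1, 6, 16853520)),
  ((1, 6, 16845392), (1, 6, 16846416)), ((1, 6, 16845424), (1, 6, 16853616)),
  ((1, 6, 16845520), (1, 6, 16846544)), ((1, 6, 16845584), (1, 6, 16846608)),
  ((1, 6, 16845776), (1, 6, 16853968)), ((1, 6, 16848912), (1, 6, 16849936)),
  ((1, 6, 16853008), (1, 6, 16853520)), ((1, 6, 16853072), (1, 6, 16853200)),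
  ((1, 6, 16853104), (1, 6, 16853616)), ((1, 6, 16857616), (1, 6, 16857744)),
  ((1, 6, 16857712), (1, 6, 16857840)), ((1, 6, 16863280), (1, 6, 16864304)),
  ((1, 6, 16863376), (1, 6, 16863440)), ((1, 6, 16871440), (1, 6, 16872464)),
  ((1, 6, 16871952), (1, 6, 16872976)), ((1, 6, 16877584), (1, 6, 16878608)),
  ((1, 6, 16896016), (1, 6, 16897040)), ((1, 6, 16896208), (1, 6, 16897232)),
  ((1, 6, 16896528), (1, 6, 16897552)), ((1, 6, 16994320), (3, 2, 16859152)),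
  ((1, 6, 17106960), (1, 6, 17107024)), ((1, 6, 17107536), (1, 6, 17115728)),
  ((1, 6, 17115216), (1, 6, 17115728)), ((1, 6, 17119824), (1, 6, 17119952)),
  ((1, 6, 17125392), (1, 6, 17133584)), ((1, 6, 17133616), (1, 6, 17133744)),
  ((1, 6, 17133648), (1, 6, 17133776)), ((1, 6, 17134096), (1, 6, 17134224)),
  ((1, 6, 17135632), (1, 6, 17135760)), ((1, 6, 17166352), (1, 6, 17166480)),
  ((1, 6, 17264656), (1, 3, 17190928)), ((1, 6, 17893392), (3, 2, 17825808)),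
  ((1, 6, 17911824), (3, 2, 17825808)), ((1, 6, 18182160), (3, 2, 16867344)),
  ((1, 6, 18941968), (1, 6, 18942032)), ((1, 6, 18942544), (1, 6, 18950736)),
  ((1, 6, 18950224), (1, 6, 18950736)), ((1, 6, 18954832), (1, 6, 18955856)),
  ((1, 6, 18960400), (1, 6, 18960912)), ((1, 6, 18969104), (1, 6, 18970128)),
  ((1, 6, 18993680), (1, 6, 18994704)), ((1, 6, 19230736), (1, 6, 19231760)),
  ((1, 6, 21039120), (3, 2, 20971536)), ((1, 6, 21057552), (3, 2, 20971536)),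
  ((1, 6, 21327888), (1, 3, 21254160)), ((1, 6, 25233424), (3, 2, 25165840)),
  ((1, 6, 25251856), (3, 2, 25165840)), ((1, 6, 25522192), (1, 3, 25448464)),
  ((3, 2, 16777232), (3, 2, 16777296)), ((3, 2, 16778288), (3, 2, 16778352)),
  ((3, 2, 16782352), (3, 2, 16784400)), ((3, 2, 16811024), (3, 2, 16811088)),
  ((3, 2, 16842768), (3, 2, 16842832)), ((3, 2, 16859184), (3, 2, 16859248)),
  ((3, 2, 16859280), (3, 2, 16859344)), ((3, 2, 16860176), (3, 2, 16860240)),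
  ((3, 2, 16861200), (3, 2, 16862224)), ((3, 2, 16863248), (3, 2, 16865296)),
  ((3, 2, 16865424), (3, 2, 16865488)), ((3, 2, 16867344), (3, 2, 16867408)),
  ((3, 2, 16867376), (3, 2, 16867440)), ((3, 2, 16867472), (3, 2, 16867536)),
  ((3, 2, 16868368), (3, 2, 16868432)), ((3, 2, 16869392), (3, 2, 16869456)),
  ((3, 2, 16870416), (3, 2, 16870480)), ((3, 2, 16871440), (3, 2, 16871504)),
  ((3, 2, 16891920), (3, 2, 16891984)), ((3, 2, 16898064), (1, 3, 16844816)),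
  ((3, 2, 16900112), (3, 2, 16900176)), ((3, 2, 16990224), (3, 2, 16990288)),
  ((3, 2, 16998416), (3, 2, 16998480)), ((3, 2, 17121296), (3, 2, 17121360)),
  ((3, 2, 17129488), (3, 2, 17129552)), ((3, 2, 17383440), (3, 2, 17383504)),
  ((3, 2, 17391632), (3, 2, 17391696)), ((3, 2, 17499152), (3, 2, 17499216)),
  ((3, 2, 17825840), (3, 2, 17825904)), ((3, 2, 17825936), (3, 2, 17826000)),
  ((3, 2, 17826832), (3, 2, 17826896)), ((3, 2, 17827856), (3, 2, 17827920)),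
  ((3, 2, 17829904), (3, 2, 17829968)), ((3, 2, 17834000), (3, 2, 17834064)),
  ((3, 2, 17842192), (3, 2, 17842256)), ((3, 2, 17858576), (3, 2, 17858640)),
  ((3, 2, 17891344), (3, 2, 17891408)), ((3, 2, 17907728), (3, 2, 17907792)),
  ((3, 2, 17915920), (3, 2, 17915984)), ((3, 2, 17956880), (3, 2, 17956944)),
  ((3, 2, 18087952), (3, 2, 18088016)), ((3, 2, 18350096), (3, 2, 18350160)),
  ((3, 2, 18956304), (3, 2, 18956368)), ((3, 2, 18964496), (3, 2, 18964560)),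
  ((3, 2, 19922960), (3, 2, 19923024)), ((3, 2, 20971568), (3, 2, 20971632)),
  ((3, 2, 20971664), (3, 2, 20971728)), ((3, 2, 20972560), (3, 2, 20972624)),
  ((3, 2, 20973584), (3, 2, 20974608)), ((3, 2, 20975632), (3, 2, 20975696)),
  ((3, 2, 20979728), (3, 2, 20979792)), ((3, 2, 20982800), (3, 2, 20982864)),
  ((3, 2, 20987920), (3, 2, 20987984)), ((3, 2, 21004304), (3, 2, 21004368)),
  ((3, 2, 21037072), (3, 2, 21037136)), ((3, 2, 21053456), (3, 2, 21053520)),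
  ((3, 2, 21061648), (3, 2, 21061712)), ((3, 2, 21102608), (3, 2, 21102672)),
  ((3, 2, 21233680), (3, 2, 21233744)), ((3, 2, 21495824), (3, 2, 21495888)),
  ((3, 2, 22020112), (3, 2, 22020176)), ((3, 2, 23068688), (3, 2, 23068752)),
  ((3, 2, 25165872), (3, 2, 25165936)), ((3, 2, 25165968), (3, 2, 25166032)),
  ((3, 2, 25166864), (3, 2, 25166928)), ((3, 2, 25167888), (3, 2, 25168912)),
  ((3, 2, 25169936), (3, 2, 25170000)), ((3, 2, 25174032), (3, 2, 25174096)),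
  ((3, 2, 25177104), (3, 2, 25177168)), ((3, 2, 25182224), (3, 2, 25182288)),
  ((3, 2, 25198608), (3, 2, 25198672)), ((3, 2, 25231376), (3, 2, 25231440)),
  ((3, 2, 25247760), (3, 2, 25247824)), ((3, 2, 25255952), (3, 2, 25256016)),
  ((3, 2, 25296912), (3, 2, 25296976)), ((3, 2, 25427984), (3, 2, 25428048)),
  ((3, 2, 25690128), (3, 2, 25690192)), ((3, 2, 26214416), (3, 2, 26214480)),
  ((3, 2, 27262992), (3, 2, 27263056)), ((3, 2, 29360144), (3, 2, 29360208)),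
  ((3, 3, 16777424), (3, 3, 16777936)), ((3, 3, 16842768), (3, 3, 16843280)),
  ((3, 3, 16851216), (3, 3, 16851280)), ((3, 3, 16851312), (3, 3, 16851824)),
  ((3, 3, 16851408), (3, 3, 16851920)), ((3, 3, 16852304), (3, 3, 16852816)),
  ((3, 3, 16853328), (3, 3, 16854352)), ((3, 3, 16854384), (3, 3, 16854896)),
  ((3, 3, 16854480), (3, 3, 16854992)), ((3, 3, 16867664), (3, 3, 16868176)),
  ((3, 3, 16870736), (3, 3, 16871248)), ((3, 3, 16884048), (3, 3, 16884560)),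
  ((3, 3, 16887120), (3, 3, 16887632)), ((3, 3, 16982352), (3, 3, 16982864)),
  ((3, 3, 16985424), (3, 3, 16985936)), ((3, 3, 17105040), (3, 3, 17105552)),
  ((3, 3, 17113424), (3, 3, 17113936)), ((3, 3, 17116496), (3, 3, 17117008)),
  ((3, 3, 17375568), (3, 3, 17376080)), ((3, 3, 17378640), (3, 3, 17379152)),
  ((3, 3, 17899856), (3, 3, 17900368)), ((3, 3, 17902928), (3, 3, 17903440)),
  ((3, 3, 18940048), (3, 3, 18940560)), ((3, 3, 18948432), (3, 3, 18948944)),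
  ((3, 3, 18951504), (3, 3, 18952016)), ((3, 3, 21045584), (3, 3, 21046096)),
  ((3, 3, 21048656), (3, 3, 21049168)), ((3, 3, 25239888), (3, 3, 25240400)),
  ((3, 3, 25242960), (3, 3, 25243472)), ((3, 4, 16777808), (3, 4, 16781904)),
  ((3, 4, 16778000), (3, 4, 16782096)), ((3, 4, 16778256), (3, 4, 16780304)),
  ((3, 4, 16780432), (3, 4, 16784528)), ((3, 4, 16781328), (3, 4, 16781840)),
  ((3, 4, 16782384), (3, 4, 16782448)), ((3, 4, 16792720), (3, 4, 16792784)),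
  ((3, 4, 16843344), (3, 4, 16847440)), ((3, 4, 16843792), (3, 4, 16974864)),
  ((3, 4, 16846864), (3, 4, 16847376)), ((3, 4, 16867408), (3, 4, 16871504)),
  ((3, 4, 16874640), (3, 4, 16874704)), ((3, 4, 17499152), (3, 4, 17503248)),
  ((3, 4, 17503280), (3, 4, 17503792)), ((3, 4, 17503376), (3, 4, 17503888)),
  ((3, 4, 17511440), (3, 4, 17511504)), ((3, 4, 17825872), (3, 4, 17829968)),
  ((3, 4, 18551824), (3, 4, 18551888)), ((3, 4, 19600400), (3, 4, 19600464)),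
  ((3, 4, 20971600), (3, 4, 20975696)), ((3, 4, 21697552), (3, 4, 21698064)),
  ((3, 4, 25165904), (3, 4, 25170000)), ((3, 4, 25891856), (3, 4, 25891920)),
  ((3, 5, 16843280), (3, 5, 16876048)), ((3, 5, 16845328), (3, 5, 16878096)),
  ((3, 5, 16851792), (3, 5, 16884560)), ((3, 5, 16854864), (3, 5, 16887632))]

/-- The chaps of the window in the starting position, in which the ball is at `(3, 4)`. -/
def startMask : ℕ := 16874512

theorem closed_alfredReplies : closed true alfredReplies = true := by decide +kernel

theorem closed_bettyReplies : closed false bettyReplies = true := by decide +kernel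

theorem known_start : known true alfredReplies (3, 4, startMask) = true := by decide +kernel

theorem movesSafe_start : movesSafe false (known false bettyReplies) (3, 4, startMask) = true := by
  decide +kernel

theorem inWin_iff {x y : ℕ} : inWin x y = true ↔ 1 ≤ x ∧ x ≤ 3 ∧ 1 ≤ y ∧ y ≤ 7 := by
  simp [inWin, and_assoc]

theorem hasBit_eq (c i : ℕ) : hasBit c i = c.testBit i := by
  have h : (c.testBit i).toNat = c / 2 ^ i % 2 := Nat.toNat_testBit c i
  have h' : Nat.land (Nat.shiftRight c i) 1 = c / 2 ^ i % 2 := by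
    change (c >>> i) &&& 1 = _
    rw [Nat.and_one_is_mod, Nat.shiftRight_eq_div_pow]
  rw [hasBit, h', ← h]
  cases c.testBit i <;> rfl

theorem hasBit_setBit (c i j : ℕ) : hasBit (setBit c i) j = (hasBit c j || decide (i = j)) := by
  rw [hasBit_eq, hasBit_eq]
  change (c ||| 2 ^ i).testBit j = _
  rw [Nat.testBit_or, Nat.testBit_two_pow]

theorem hasBit_eraseRay (e f x y c j : ℕ) : ∀ k, hasBit (eraseRay e f x y c k) j = true ↔
    hasBit c j = true ∧ ∀ i, 1 ≤ i → i ≤ k → j ≠ rayBit e f x y i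
  | 0 => by
    simp only [eraseRay]
    exact ⟨fun h => ⟨h, fun i _ _ => by omega⟩, fun h => h.1⟩
  | k + 1 => by
    have ih := hasBit_eraseRay e f x y c j k
    have hx : hasBit (eraseRay e f x y c (k + 1)) j =
        ((hasBit (eraseRay e f x y c k) j || decide (rayBit e f x y (k + 1) = j)) ^^
          decide (rayBit e f x y (k + 1) = j)) := by
      rw [← hasBit_setBit, hasBit_eq, hasBit_eq]
      change (setBit (eraseRay e f x y c k) (rayBit e f x y (k + 1)) ^^^
        2 ^ rayBit e f x y (k + 1)).testBit j = _
      rw [Nat.testBit_xor, Nat.testBit_two_pow]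
    rw [hx]
    by_cases hj : rayBit e f x y (k + 1) = j
    · simp only [hj, decide_true, Bool.or_true, Bool.xor_self, Bool.false_eq_true, false_iff]
      exact fun h => h.2 (k + 1) (by omega) le_rfl hj.symm
    · simp only [hj, decide_false, Bool.or_false, Bool.xor_false, ih]
      refine and_congr_right fun _ => ⟨fun h i h1 h2 => ?_, fun h i h1 h2 => h i h1 (by omega)⟩
      rcases Nat.lt_or_ge k i with hi | hi
      · obtain rfl : i = k + 1 := by omega
        exact fun h => hj h.symm
      · exact h i h1 hi

theorem firstFree_spec (e f x y c : ℕ) : ∀ k i, i ≤ firstFree e f x y c k i ∧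
    firstFree e f x y c k i ≤ i + k ∧
    (∀ j, i ≤ j → j < firstFree e f x y c k i → chapAt e f x y c j = true) ∧
    (firstFree e f x y c k i < i + k → chapAt e f x y c (firstFree e f x y c k i) = false)
  | 0, i => ⟨le_rfl, le_rfl, fun j h1 h2 => by simp only [firstFree] at h2; omega,
      fun h => by simp only [firstFree] at h; omega⟩
  | k + 1, i => by
    obtain ⟨h1, h2, h3, h4⟩ := firstFree_spec e f x y c k (i + 1)
    cases h : chapAt e f x y c i
    · have : firstFree e f x y c (k + 1) i = i := by simp [firstFree, h]
      rw [this]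
      exact ⟨le_rfl, by omega, fun j _ _ => by omega, fun _ => h⟩
    · have : firstFree e f x y c (k + 1) i = firstFree e f x y c k (i + 1) := by
        simp [firstFree, h]
      rw [this]
      refine ⟨by omega, by omega, fun j hj1 hj2 => ?_, fun hj => h4 (by omega)⟩
      rcases Nat.eq_or_lt_of_le hj1 with rfl | hj
      · exact h
      · exact h3 j hj hj2

theorem dirCodes_spec {e f : ℕ} (h : (e, f) ∈ dirCodes) : e ≤ 2 ∧ f ≤ 2 ∧ ¬(e = 1 ∧ f = 1) := by
  simp only [dirCodes, List.mem_cons, Prod.mk.injEq, List.not_mem_nil, or_false] at h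
  omega

theorem mem_dirs_of_mem_dirCodes {e f : ℕ} (h : (e, f) ∈ dirCodes) :
    ((e : ℤ) - 1, (f : ℤ) - 1) ∈ dirs := by
  simp only [dirCodes, List.mem_cons, Prod.mk.injEq, List.not_mem_nil, or_false] at h
  rcases h with h | h | h | h | h | h | h | h <;> obtain ⟨rfl, rfl⟩ := h <;> decide

theorem exists_dirCode {d : ℤ × ℤ} (h : d ∈ dirs) :
    ∃ e f : ℕ, (e, f) ∈ dirCodes ∧ d = ((e : ℤ) - 1, (f : ℤ) - 1) := by
  simp only [dirs, Finset.mem_insert, Finset.mem_singleton] at h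
  rcases h with rfl | rfl | rfl | rfl | rfl | rfl | rfl | rfl
  exacts [⟨2, 1, by decide, rfl⟩, ⟨2, 2, by decide, rfl⟩, ⟨1, 2, by decide, rfl⟩,
    ⟨0, 2, by decide, rfl⟩, ⟨0, 1, by decide, rfl⟩, ⟨0, 0, by decide, rfl⟩,
    ⟨1, 0, by decide, rfl⟩, ⟨2, 0, by decide, rfl⟩]

/-- A point of the window is reached by a ray over `ℕ` iff it is reached by the ray over `ℤ`. -/
theorem step_eq_iff {x e i a : ℕ} (he : e ≤ 2) (ha : 1 ≤ a) :
    step x e i = a ↔ (x : ℤ) + i * ((e : ℤ) - 1) = a := by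
  change x + i * e - i = a ↔ _
  interval_cases e <;> push_cast <;> omega

theorem not_inWin_step {e f x y : ℕ} (he : e ≤ 2) (hf : f ≤ 2) (hef : ¬(e = 1 ∧ f = 1))
    (h : inWin x y = true) : inWin (step x e 8) (step y f 8) = false := by
  rw [Bool.eq_false_iff, ne_eq, inWin_iff]
  rw [inWin_iff] at h
  change ¬(1 ≤ x + 8 * e - 8 ∧ x + 8 * e - 8 ≤ 3 ∧ 1 ≤ y + 8 * f - 8 ∧ y + 8 * f - 8 ≤ 7)
  omega

/-- The first point of a ray without a chap of the window is found within eight steps. -/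
theorem firstFree_eight {e f x y : ℕ} (c : ℕ) (he : e ≤ 2) (hf : f ≤ 2) (hef : ¬(e = 1 ∧ f = 1))
    (h : inWin x y = true) : 1 ≤ firstFree e f x y c 8 1 ∧
      (∀ i, 1 ≤ i → i < firstFree e f x y c 8 1 → chapAt e f x y c i = true) ∧
      chapAt e f x y c (firstFree e f x y c 8 1) = false := by
  obtain ⟨h1, h2, h3, h4⟩ := firstFree_spec e f x y c 8 1
  refine ⟨h1, h3, h4 ?_⟩
  by_contra hlt
  have h8 := h3 8 (by omega) (by omega)
  simp [chapAt, not_inWin_step he hf hef h] at h8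

/-- Position of a `3 × 7` window in the `m × n` board, whose window point `(1, 1)` is the board
point `(X + 1, Y + 1)`. Diagonal rays starting close to the middle of the window leave the board
through the sidelines. -/
structure Frame (m n X Y : ℤ) : Prop where
  left : 0 ≤ X
  right : X + 3 ≤ n
  bottom : 1 ≤ Y
  top : Y + 8 ≤ m
  up_right : n - X + 3 ≤ m - Y
  up_left : X + Y + 6 ≤ m
  down_right : n - X - Y ≤ 4
  down_left : X ≤ Y + 2

/-- The chaps are those of the window encoded by `c`, and all points outside the window. -/
def Represents (m n X Y : ℤ) (C : Finset (ℤ × ℤ)) (c : ℕ) : Prop :=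
  ∀ u v : ℤ, (u, v) ∈ C ↔ OnBoard m n (u, v) ∧
    ∀ a b : ℕ, inWin a b = true → u = X + a → v = Y + b → hasBit c (3 * b + a) = true

section

variable {m n X Y : ℤ} {C C' : Finset (ℤ × ℤ)} {c x y e f : ℕ}

theorem Frame.onBoard (F : Frame m n X Y) (h : inWin x y = true) :
    OnBoard m n (X + x, Y + y) := by
  obtain ⟨h1, h2, h3, h4, -, -, -, -⟩ := F
  rw [inWin_iff] at h
  refine ⟨?_, ?_, ?_, ?_⟩ <;> dsimp only <;> omega

theorem Represents.mem_iff (F : Frame m n X Y) (R : Represents m n X Y C c) (h : inWin x y = true) :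
    ((X + x, Y + y) : ℤ × ℤ) ∈ C ↔ hasBit c (3 * y + x) = true := by
  rw [R]
  refine ⟨fun hC => hC.2 x y h rfl rfl, fun hbit => ⟨F.onBoard h, fun a b _ ha hb => ?_⟩⟩
  obtain rfl : x = a := by omega
  obtain rfl : y = b := by omega
  exact hbit

/-- The ray from a window point. -/
abbrev windowRay (X Y : ℤ) (e f x y : ℕ) (i : ℤ) : ℤ × ℤ :=
  ray (X + x, Y + y) ((e : ℤ) - 1, (f : ℤ) - 1) i

theorem windowRay_eq_iff {i a b : ℕ} (he : e ≤ 2) (hf : f ≤ 2) (h : inWin a b = true) :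
    windowRay X Y e f x y i = (X + a, Y + b) ↔ step x e i = a ∧ step y f i = b := by
  rw [inWin_iff] at h
  rw [step_eq_iff he h.1, step_eq_iff hf h.2.2.1]
  simp only [windowRay, ray, Prod.mk.injEq]
  constructor <;> rintro ⟨h1, h2⟩ <;> constructor <;> linarith

theorem windowRay_of_inWin {i : ℕ} (he : e ≤ 2) (hf : f ≤ 2)
    (h : inWin (step x e i) (step y f i) = true) :
    windowRay X Y e f x y i = (X + step x e i, Y + step y f i) :=
  (windowRay_eq_iff he hf h).2 ⟨rfl, rfl⟩

theorem Represents.ray_mem_of_chapAt (F : Frame m n X Y) (R : Represents m n X Y C c)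
    {i : ℕ} (he : e ≤ 2) (hf : f ≤ 2) (h : chapAt e f x y c i = true) :
    windowRay X Y e f x y i ∈ C := by
  rw [chapAt, Bool.and_eq_true] at h
  rw [windowRay_of_inWin he hf h.1, R.mem_iff F h.1]
  exact h.2

theorem Represents.ray_mem_of_outside (R : Represents m n X Y C c) {i : ℕ} (he : e ≤ 2) (hf : f ≤ 2)
    (h : inWin (step x e i) (step y f i) = false) :
    windowRay X Y e f x y i ∈ C ↔ OnBoard m n (windowRay X Y e f x y i) := by
  refine (R _ _).trans (and_iff_left fun a b hab ha hb => ?_)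
  have := (windowRay_eq_iff (X := X) (Y := Y) (x := x) (y := y) (i := i) he hf hab).1
    (Prod.ext ha hb)
  rw [this.1, this.2, hab] at h
  cases h

theorem Represents.ray_notMem_of_inWin (F : Frame m n X Y) (R : Represents m n X Y C c)
    {i : ℕ} (he : e ≤ 2) (hf : f ≤ 2) (h : inWin (step x e i) (step y f i) = true)
    (h' : chapAt e f x y c i = false) : windowRay X Y e f x y i ∉ C := by
  rw [windowRay_of_inWin he hf h, R.mem_iff F h]
  rw [chapAt, h, Bool.true_and] at h'
  exact fun h2 => Bool.false_ne_true (h'.symm.trans h2)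

theorem Represents.sdiff_ray (R : Represents m n X Y C c) (he : e ≤ 2) (hf : f ≤ 2) {k : ℕ}
    (h : ∀ i, 1 ≤ i → i ≤ k → chapAt e f x y c i = true) :
    Represents m n X Y (C \ Finset.image (fun i : ℕ => windowRay X Y e f x y i) (Finset.Icc 1 k))
      (eraseRay e f x y c k) := by
  intro u v
  simp only [Finset.mem_sdiff, Finset.mem_image, Finset.mem_Icc, not_exists, not_and, R u v]
  constructor
  · rintro ⟨⟨hB, hw⟩, hr⟩
    refine ⟨hB, fun a b hab hu hv => (hasBit_eraseRay ..).2
      ⟨hw a b hab hu hv, fun i h1 h2 hi => ?_⟩⟩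
    have hi' := h i h1 h2
    rw [chapAt, Bool.and_eq_true, inWin_iff] at hi'
    rw [inWin_iff] at hab
    change 3 * b + a = 3 * step y f i + step x e i at hi
    refine hr i ⟨h1, h2⟩ ?_
    rw [hu, hv]
    exact (windowRay_eq_iff he hf (inWin_iff.2 hab)).2 (by omega)
  · rintro ⟨hB, hw⟩
    refine ⟨⟨hB, fun a b hab hu hv => ((hasBit_eraseRay ..).1 (hw a b hab hu hv)).1⟩, ?_⟩
    rintro i ⟨h1, h2⟩ hi
    have hi' := h i h1 h2
    rw [chapAt, Bool.and_eq_true] at hi'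
    rw [windowRay_of_inWin he hf hi'.1, Prod.mk.injEq] at hi
    exact ((hasBit_eraseRay ..).1 (hw _ _ hi'.1 hi.1.symm hi.2.symm)).2 i h1 h2 rfl

theorem Represents.insert_point (R : Represents m n X Y C c) (F : Frame m n X Y) {a b : ℕ}
    (h : inWin a b = true) :
    Represents m n X Y (insert (X + a, Y + b) C) (setBit c (3 * b + a)) := by
  intro u v
  rw [Finset.mem_insert, R u v, Prod.mk.injEq]
  simp only [hasBit_setBit, Bool.or_eq_true, decide_eq_true_eq]
  constructor
  · rintro (⟨rfl, rfl⟩ | ⟨hB, hw⟩)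
    · exact ⟨F.onBoard h, fun a' b' _ _ _ => by omega⟩
    · exact ⟨hB, fun a' b' h' hu hv => Or.inl (hw a' b' h' hu hv)⟩
  · rintro ⟨hB, hw⟩
    by_cases huv : u = X + a ∧ v = Y + b
    · exact Or.inl huv
    · refine Or.inr ⟨hB, fun a' b' h' hu hv => (hw a' b' h' hu hv).resolve_right fun hab => huv ?_⟩
      rw [inWin_iff] at h h'
      omega

/-- A hop within the window. -/
theorem Represents.hop (F : Frame m n X Y) (R : Represents m n X Y C c) (hd : (e, f) ∈ dirCodes)
    (hxy : inWin x y = true) (hj : firstFree e f x y c 8 1 ≠ 1)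
    (hw : inWin (step x e (firstFree e f x y c 8 1)) (step y f (firstFree e f x y c 8 1)) = true) :
    ∃ C', Represents m n X Y C' (eraseRay e f x y c (firstFree e f x y c 8 1 - 1)) ∧
      Hop n (X + x, Y + y) C (X + step x e (firstFree e f x y c 8 1),
        Y + step y f (firstFree e f x y c 8 1)) C' := by
  obtain ⟨he, hf, hef⟩ := dirCodes_spec hd
  obtain ⟨h1, h2, h3⟩ := firstFree_eight c he hf hef hxy
  generalize firstFree e f x y c 8 1 = j at *
  obtain ⟨k, rfl⟩ : ∃ k, j = k + 1 := ⟨j - 1, by omega⟩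
  have hr := windowRay_of_inWin (X := X) (Y := Y) he hf hw
  have hB := F.onBoard hw
  rw [Nat.add_sub_cancel]
  refine ⟨_, R.sdiff_ray he hf fun i hi1 hi2 => h2 i hi1 (by omega), _, mem_dirs_of_mem_dirCodes hd,
    k, by omega, fun i hi1 hi2 => R.ray_mem_of_chapAt F he hf (h2 i hi1 (by omega)), ?_, ?_, ?_,
    ?_, rfl⟩ <;> rw [← Nat.cast_add_one]
  · exact R.ray_notMem_of_inWin F he hf hw h3
  · exact (congrArg Prod.fst hr).symm ▸ hB.1
  · exact (congrArg Prod.fst hr).symm ▸ hB.2.1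
  · exact hr.symm

/-- Every hop starting in the window either stays in the window or crosses a goalline. -/
theorem Represents.of_hop (F : Frame m n X Y) (R : Represents m n X Y C c) (hxy : inWin x y = true)
    {q : ℤ × ℤ} (H : Hop n (X + x, Y + y) C q C') :
    ∃ e f, (e, f) ∈ dirCodes ∧
      ((firstFree e f x y c 8 1 ≠ 1 ∧
        inWin (step x e (firstFree e f x y c 8 1)) (step y f (firstFree e f x y c 8 1)) = true ∧
        q = (X + step x e (firstFree e f x y c 8 1), Y + step y f (firstFree e f x y c 8 1)) ∧
        Represents m n X Y C' (eraseRay e f x y c (firstFree e f x y c 8 1 - 1))) ∨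
      (inWin (step x e (firstFree e f x y c 8 1)) (step y f (firstFree e f x y c 8 1)) = false ∧
        ((m < q.2 ∧ mayExit true e f x y = true) ∨ (q.2 < 1 ∧ mayExit false e f x y = true)))) := by
  obtain ⟨d, hd, k, hk, hC, hk', hq1, hq2, rfl, rfl⟩ := H
  obtain ⟨e, f, hd', rfl⟩ := exists_dirCode hd
  obtain ⟨he, hf, hef⟩ := dirCodes_spec hd'
  obtain ⟨h1, h2, h3⟩ := firstFree_eight c he hf hef hxy
  refine ⟨e, f, hd', ?_⟩
  generalize firstFree e f x y c 8 1 = j at *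
  have hjk : j ≤ k + 1 := by
    by_contra hjk
    have := R.ray_mem_of_chapAt F he hf (h2 (k + 1) (by omega) (by omega))
    rw [Nat.cast_add_one] at this
    exact hk' this
  cases hw : inWin (step x e j) (step y f j)
  · right
    refine ⟨rfl, ?_⟩
    have hout : inWin (step x e (k + 1)) (step y f (k + 1)) = false := by
      rw [Bool.eq_false_iff, ne_eq, inWin_iff] at hw ⊢
      rw [inWin_iff] at hxy
      intro hw'
      apply hw
      obtain ⟨ha, hb, hc, hc'⟩ := hw'
      have hx := (step_eq_iff (x := x) (i := k + 1) he ha).1 rfl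
      have hy := (step_eq_iff (x := y) (i := k + 1) hf hc).1 rfl
      clear hd hd' hq1 hq2 hk' hC
      generalize step x e (k + 1) = p at *
      generalize step y f (k + 1) = r at *
      change 1 ≤ x + j * e - j ∧ x + j * e - j ≤ 3 ∧ 1 ≤ y + j * f - j ∧ y + j * f - j ≤ 7
      push_cast at hx hy
      interval_cases e <;> interval_cases f <;> push_cast at hx hy <;> omega
    have hB := (not_congr (R.ray_mem_of_outside (m := m) (n := n) he hf hout)).1
      (by rw [Nat.cast_add_one]; exact hk')
    rw [Nat.cast_add_one] at hB
    have hpre : OnBoard m n (windowRay X Y e f x y k) := by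
      have := (R _ _).1 (hC k hk le_rfl)
      exact this.1
    obtain ⟨F1, F2, F3, F4, F5, F6, F7, F8⟩ := F
    simp only [OnBoard, windowRay, ray] at hB hpre hq1 hq2 ⊢
    rw [inWin_iff] at hxy
    clear h2 h3 hw hout hC hk' R hd hd'
    simp only [mayExit, cond_true, cond_false, Bool.and_eq_true, Bool.or_eq_true, Nat.beq_eq,
      Nat.ble_eq]
    change (_ ∧ f = 2 ∧ ((e = 1 ∨ e = 2 ∧ x + 4 ≤ y) ∨ e = 0 ∧ 8 ≤ x + y)) ∨
      (_ ∧ f = 0 ∧ ((e = 1 ∨ e = 2 ∧ x + y ≤ 4) ∨ e = 0 ∧ y ≤ x + 1))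
    interval_cases e <;> interval_cases f <;>
      push_cast at hB hpre hq1 hq2 <;> omega
  · left
    have hjk' : j = k + 1 := by
      by_contra hne
      exact R.ray_notMem_of_inWin F he hf hw h3 (hC j h1 (by omega))
    subst hjk'
    refine ⟨by omega, rfl, ?_, ?_⟩
    · rw [← windowRay_of_inWin he hf hw, Nat.cast_add_one]
    · exact R.sdiff_ray he hf fun i hi1 hi2 => h2 i hi1 (by omega)

/-- The ball has been carried past the goalline of player `p`. -/
def PastGoal (m : ℤ) (p : Player) (b : ℤ × ℤ) : Prop :=
  (p = true ∧ m < b.2) ∨ (p = false ∧ b.2 < 1)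

theorem PastGoal.winner_eq {p : Player} {s : PState} (hm : 1 ≤ m) (h : PastGoal m p s.ball) :
    winner m s = some p := by
  rcases h with ⟨rfl, h⟩ | ⟨rfl, h⟩
  · rw [winner, if_pos h.le]
  · rw [winner, if_neg (by omega), if_pos h.le]

theorem Frame.winner_eq_none (F : Frame m n X Y) (h : inWin x y = true) {s : PState}
    (hs : s.ball = (X + x, Y + y)) : winner m s = none := by
  obtain ⟨-, -, h3, h4, -, -, -, -⟩ := F
  rw [inWin_iff] at h
  rw [winner, hs, if_neg (by dsimp only; omega), if_neg (by dsimp only; omega)]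

theorem Represents.jumpsSafe_hop (F : Frame m n X Y) (R : Represents m n X Y C c)
    (hxy : inWin x y = true) {p : Player} {K : Cfg → Bool} {k : ℕ}
    (hs : jumpsSafe p K (k + 1) (x, y, c) = true) {q : ℤ × ℤ} (H : Hop n (X + x, Y + y) C q C') :
    (∃ x' y' c', inWin x' y' = true ∧ q = (X + x', Y + y') ∧ Represents m n X Y C' c' ∧
      K (x', y', c') = true ∧ jumpsSafe p K k (x', y', c') = true) ∨ PastGoal m p q := by
  obtain ⟨e, f, hd, h⟩ := R.of_hop F hxy H
  have hs' := List.all_eq_true.1 hs (e, f) hd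
  dsimp only at hs'
  rcases h with ⟨hj, hw, hq, R'⟩ | ⟨hw, h⟩
  · rw [hw, cond_true, Bool.or_eq_true, Bool.and_eq_true, Nat.beq_eq] at hs'
    exact Or.inl ⟨_, _, _, hw, hq, R', hs'.resolve_left hj⟩
  · right
    rw [hw, cond_false, Bool.not_eq_true'] at hs'
    rcases h with ⟨hq, he⟩ | ⟨hq, he⟩ <;> cases p
    · exact absurd (he.symm.trans hs') (by decide)
    · exact Or.inl ⟨rfl, hq⟩
    · exact Or.inr ⟨rfl, hq⟩
    · exact absurd (he.symm.trans hs') (by decide)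

/-- Every jump from a configuration satisfying `jumpsSafe` leads to a configuration satisfying
`K`, or wins the game for `p`. -/
theorem Represents.jumpsSafe_jump (F : Frame m n X Y) {p : Player} {K : Cfg → Bool}
    {b b' : ℤ × ℤ} (H : Jump m n b C b' C') : ∀ {k x y c}, b = (X + (x : ℕ), Y + (y : ℕ)) →
      inWin x y = true → Represents m n X Y C c → jumpsSafe p K k (x, y, c) = true →
      (∃ x' y' c', inWin x' y' = true ∧ b' = (X + (x' : ℕ), Y + (y' : ℕ)) ∧
        Represents m n X Y C' c' ∧ K (x', y', c') = true) ∨ PastGoal m p b' := by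
  induction H with
  | single H =>
    intro k x y c hb hxy R hs
    subst hb
    cases k with
    | zero => cases hs
    | succ k =>
      exact (R.jumpsSafe_hop F hxy hs H).imp_left fun ⟨x', y', c', h1, h2, h3, h4, _⟩ =>
        ⟨x', y', c', h1, h2, h3, h4⟩
  | cons H hl hu _ ih =>
    intro k x y c hb hxy R hs
    subst hb
    cases k with
    | zero => cases hs
    | succ k =>
      rcases R.jumpsSafe_hop F hxy hs H with ⟨x', y', c', h1, h2, h3, -, h5⟩ | h
      · exact ih h2 h1 h3 h5
      · rcases h with ⟨-, h⟩ | ⟨-, h⟩ <;> omega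

theorem mem_cells {a b : ℕ} : (a, b) ∈ cells ↔ inWin a b = true := by
  simp only [cells, List.pair_mem_product, List.mem_cons, List.not_mem_nil, or_false, inWin_iff]
  omega

/-- Every legal placement is inside the window. -/
theorem Represents.exists_of_notMem (R : Represents m n X Y C c) {q : ℤ × ℤ}
    (hB : OnBoard m n q) (hq : q ∉ C) :
    ∃ a b, inWin a b = true ∧ q = (X + (a : ℕ), Y + (b : ℕ)) ∧ hasBit c (3 * b + a) = false := by
  by_contra hne
  refine hq ((R q.1 q.2).2 ⟨hB, fun a b h hu hv => ?_⟩)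
  rw [← Bool.not_eq_false]
  exact fun hbit => hne ⟨a, b, h, Prod.ext hu hv, hbit⟩

/-- Every move from a configuration satisfying `movesSafe` leads to a configuration satisfying
`K`, or wins the game for `p`. -/
theorem Represents.movesSafe_move (F : Frame m n X Y) {p : Player} {K : Cfg → Bool} {s t : PState}
    (hs : s.ball = (X + x, Y + y)) (hxy : inWin x y = true) (R : Represents m n X Y s.chaps c)
    (hc : movesSafe p K (x, y, c) = true) (H : MoveRel m n s t) :
    (∃ x' y' c', inWin x' y' = true ∧ t.ball = (X + (x' : ℕ), Y + (y' : ℕ)) ∧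
      Represents m n X Y t.chaps c' ∧ K (x', y', c') = true) ∨ PastGoal m p t.ball := by
  rw [movesSafe, Bool.and_eq_true] at hc
  rcases H.2 with ⟨q, hB, hq, hne, htb, htc⟩ | J
  · obtain ⟨a, b, hab, rfl, hbit⟩ := R.exists_of_notMem hB hq
    have hK := List.all_eq_true.1 hc.2 (a, b) (mem_cells.2 hab)
    dsimp only at hK
    change (hasBit c (3 * b + a) || (Nat.beq a x && Nat.beq b y) ||
      K (x, y, setBit c (3 * b + a))) = true at hK
    rw [hbit, Bool.false_or, Bool.or_eq_true, Bool.and_eq_true, Nat.beq_eq, Nat.beq_eq] at hK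
    left
    refine ⟨x, y, _, hxy, htb.trans hs, htc ▸ R.insert_point F hab, hK.resolve_left ?_⟩
    rintro ⟨rfl, rfl⟩
    exact hne hs.symm
  · exact R.jumpsSafe_jump F J hs hxy hc.1

theorem sameCfg_iff {s t : Cfg} : sameCfg s t = true ↔ s = t := by
  obtain ⟨a, b, c⟩ := s
  obtain ⟨a', b', c'⟩ := t
  simp only [sameCfg, Bool.and_eq_true, Nat.beq_eq, Prod.mk.injEq]
  tauto

/-- A vertical hop out of the window carries the ball past a goalline. -/
theorem Represents.exists_hop_pastGoal (F : Frame m n X Y) (R : Represents m n X Y C c)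
    (hxy : inWin x y = true) (p : Player) (hd : (1, bif p then 2 else 0) ∈ dirCodes)
    (hw : inWin (step x 1 (firstFree 1 (bif p then 2 else 0) x y c 8 1))
      (step y (bif p then 2 else 0) (firstFree 1 (bif p then 2 else 0) x y c 8 1)) = false) :
    ∃ q C', Hop n (X + x, Y + y) C q C' ∧ PastGoal m p q := by
  obtain ⟨he, hf, hef⟩ := dirCodes_spec hd
  obtain ⟨-, h2, -⟩ := firstFree_eight c he hf hef hxy
  obtain ⟨hl, hr, hb, ht⟩ := F.onBoard hxy
  obtain ⟨-, -, hY, hY', -, -, -, -⟩ := id F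
  have hxy' := inWin_iff.1 hxy
  dsimp only at hl hr hb ht
  have hC : ∀ i : ℕ, 1 ≤ i → OnBoard m n (windowRay X Y 1 (bif p then 2 else 0) x y i) →
      windowRay X Y 1 (bif p then 2 else 0) x y i ∈ C := by
    intro i hi hB
    rcases Nat.lt_or_ge i (firstFree 1 (bif p then 2 else 0) x y c 8 1) with hij | hij
    · exact R.ray_mem_of_chapAt F he hf (h2 i hi hij)
    · refine (R.ray_mem_of_outside he hf ?_).2 hB
      rw [Bool.eq_false_iff, ne_eq, inWin_iff] at hw ⊢
      generalize firstFree 1 (bif p then 2 else 0) x y c 8 1 = j at *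
      change ¬(1 ≤ x + j * 1 - j ∧ x + j * 1 - j ≤ 3 ∧
        1 ≤ y + j * (bif p then 2 else 0) - j ∧ y + j * (bif p then 2 else 0) - j ≤ 7) at hw
      change ¬(1 ≤ x + i * 1 - i ∧ x + i * 1 - i ≤ 3 ∧
        1 ≤ y + i * (bif p then 2 else 0) - i ∧ y + i * (bif p then 2 else 0) - i ≤ 7)
      cases p <;> simp only [cond_true, cond_false] at hw ⊢ <;> omega
  have hk : ∃ k : ℕ, 1 ≤ k ∧ (k : ℤ) = bif p then m - (Y + y) else Y + y - 1 := by
    cases p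
    · exact ⟨(Y + y - 1).toNat, by omega, by rw [cond_false]; omega⟩
    · exact ⟨(m - (Y + y)).toNat, by omega, by rw [cond_true]; omega⟩
  obtain ⟨k, hk, hkm⟩ := hk
  refine ⟨_, _, ⟨_, mem_dirs_of_mem_dirCodes hd, k, hk, fun i hi hik => hC i hi ?_, fun h => ?_,
    ?_, ?_, rfl, rfl⟩, ?_⟩
  · cases p <;> simp only [cond_true, cond_false] at hkm ⊢ <;>
      refine ⟨?_, ?_, ?_, ?_⟩ <;> simp only [windowRay, ray] <;> push_cast <;> omega
  · obtain ⟨-, -, h3, h4⟩ := ((R _ _).1 h).1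
    cases p <;> simp only [cond_true, cond_false] at hkm h3 h4 <;> push_cast at h3 h4 <;> omega
  · simp only [ray]
    push_cast
    omega
  · simp only [ray]
    push_cast
    omega
  · cases p
    · refine Or.inr ⟨rfl, ?_⟩
      simp only [ray, cond_false] at hkm ⊢
      push_cast
      omega
    · refine Or.inl ⟨rfl, ?_⟩
      simp only [ray, cond_true] at hkm ⊢
      push_cast
      omega

theorem Represents.exists_jump_of_winJump (F : Frame m n X Y) {p : Player} :
    ∀ {k x y c C}, Represents m n X Y C c → inWin x y = true → winJump p k (x, y, c) = true →
      ∃ q C', Jump m n (X + (x : ℕ), Y + (y : ℕ)) C q C' ∧ PastGoal m p q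
  | 0, _, _, _, _, _, _, h => by cases h
  | k + 1, x, y, c, C, R, hxy, h => by
    obtain ⟨⟨e, f⟩, hd, h⟩ := List.any_eq_true.1 h
    replace hd : (e, f) ∈ dirCodes := by
      cases p
      · exact List.mem_reverse.1 hd
      · exact hd
    dsimp only at h
    cases hw : inWin (step x e (firstFree e f x y c 8 1)) (step y f (firstFree e f x y c 8 1))
    · rw [hw, cond_false, Bool.and_eq_true, Nat.beq_eq, Nat.beq_eq] at h
      obtain ⟨rfl, rfl⟩ := h
      obtain ⟨q, C', H, hq⟩ := R.exists_hop_pastGoal F hxy p hd hw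
      exact ⟨q, C', .single H, hq⟩
    · rw [hw, cond_true, Bool.and_eq_true, Bool.not_eq_true', ← Bool.not_eq_true, Nat.beq_eq] at h
      obtain ⟨C₁, R₁, H⟩ := R.hop F hd hxy h.1 hw
      obtain ⟨q, C', J, hq⟩ := exists_jump_of_winJump F R₁ hw h.2
      exact ⟨q, C', .cons H (F.onBoard hw).2.2.1 (F.onBoard hw).2.2.2 J, hq⟩

theorem Represents.exists_jump_of_canJump (F : Frame m n X Y) {x' y' c' : ℕ} :
    ∀ {k x y c C}, Represents m n X Y C c → inWin x y = true →
      canJump (x', y', c') k (x, y, c) = true →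
      ∃ C', Jump m n (X + (x : ℕ), Y + (y : ℕ)) C (X + x', Y + y') C' ∧
        Represents m n X Y C' c'
  | 0, _, _, _, _, _, _, h => by cases h
  | k + 1, x, y, c, C, R, hxy, h => by
    obtain ⟨⟨e, f⟩, hd, h⟩ := List.any_eq_true.1 h
    simp only [Bool.and_eq_true, Bool.or_eq_true, Bool.not_eq_true', sameCfg_iff,
      Prod.mk.injEq] at h
    obtain ⟨⟨hw, hj⟩, h⟩ := h
    rw [← Bool.not_eq_true, Nat.beq_eq] at hj
    obtain ⟨C₁, R₁, H⟩ := R.hop F hd hxy hj hw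
    rcases h with ⟨rfl, rfl, rfl⟩ | h
    · exact ⟨C₁, .single H, R₁⟩
    · obtain ⟨C', J, R'⟩ := exists_jump_of_canJump F R₁ hw h
      exact ⟨C', .cons H (F.onBoard hw).2.2.1 (F.onBoard hw).2.2.2 J, R'⟩

theorem Represents.exists_move_of_canPlace (F : Frame m n X Y) {s : PState}
    (hs : s.ball = (X + x, Y + y)) (R : Represents m n X Y s.chaps c) {r : Cfg}
    (h : canPlace (x, y, c) r = true) : ∃ t, MoveRel m n s t ∧
      t.ball = (X + r.1, Y + r.2.1) ∧ Represents m n X Y t.chaps r.2.2 := by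
  obtain ⟨⟨a, b⟩, hab, h⟩ := List.any_eq_true.1 h
  rw [mem_cells] at hab
  simp only [Bool.and_eq_true, Bool.not_eq_true', sameCfg_iff] at h
  obtain ⟨⟨hbit, hne⟩, rfl⟩ := h
  refine ⟨⟨s.ball, insert (X + (a : ℤ), Y + (b : ℤ)) s.chaps, !s.turn⟩,
    ⟨rfl, Or.inl ⟨_, F.onBoard hab, fun h => ?_, fun h => ?_, rfl, rfl⟩⟩, hs, R.insert_point F hab⟩
  · exact Bool.false_ne_true (hbit.symm.trans ((R.mem_iff F hab).1 h))
  · rw [hs, Prod.mk.injEq] at h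
    rw [← Bool.not_eq_true, Bool.and_eq_true, Nat.beq_eq, Nat.beq_eq] at hne
    omega

end

theorem DrawsFrom.of_invariant {m n : ℤ} {p : Player} (I : PState → Prop)
    (hI : ∀ s, I s → winner m s ≠ some (!p))
    (hp : ∀ s, I s → s.turn = p → winner m s = none → ∃ t, MoveRel m n s t ∧ I t)
    (ho : ∀ s t, I s → s.turn = !p → winner m s = none → MoveRel m n s t → I t)
    {s₀ : PState} (h₀ : I s₀) : DrawsFrom m n p s₀ := by
  have hσ : ∀ s, ∃ t, ((∃ t, MoveRel m n s t) → MoveRel m n s t) ∧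
      ((∃ t, MoveRel m n s t ∧ I t) → I t) := by
    intro s
    by_cases h : ∃ t, MoveRel m n s t ∧ I t
    · obtain ⟨t, h⟩ := h
      exact ⟨t, fun _ => h.1, fun _ => h.2⟩
    · by_cases h' : ∃ t, MoveRel m n s t
      · exact h'.imp fun t ht => ⟨fun _ => ht, fun h'' => absurd h'' h⟩
      · exact ⟨s, fun h'' => absurd h'' h', fun h'' => absurd h'' h⟩
  choose σ hσ using hσ
  refine ⟨σ, fun s _ _ h => (hσ s).1 h, fun f hf hf₀ hfol k => hI _ ?_⟩
  induction k with
  | zero => rwa [hf₀]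
  | succ k ih =>
    rcases hf k with ⟨hw, hm, hmove⟩ | ⟨-, hk⟩
    · by_cases ht : (f k).turn = p
      · rw [hfol k ht hw hm]
        exact (hσ _).2 (hp _ ih ht hw)
      · exact ho _ _ ih (Bool.eq_not.2 ht) hw hmove
    · rwa [hk]

/-- Either player `p` has won, or the position is a configuration of the window which is
recognised as safe for `p`. -/
def SafeFor (m n X Y : ℤ) (p : Player) (L : List (Cfg × Cfg)) (s : PState) : Prop :=
  winner m s = some p ∨ ∃ x y c : ℕ, inWin x y = true ∧ s.ball = (X + x, Y + y) ∧
    Represents m n X Y s.chaps c ∧ (s.turn = p → known p L (x, y, c) = true) ∧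
    (s.turn = !p → movesSafe p (known p L) (x, y, c) = true)

theorem SafeFor.drawsFrom {m n X Y : ℤ} (F : Frame m n X Y) {p : Player} {L : List (Cfg × Cfg)}
    (hL : closed p L = true) {s₀ : PState} (h₀ : SafeFor m n X Y p L s₀) :
    DrawsFrom m n p s₀ := by
  have hm : 1 ≤ m := by
    have := F.bottom
    have := F.top
    omega
  refine DrawsFrom.of_invariant (SafeFor m n X Y p L) ?_ ?_ ?_ h₀
  · rintro s (h | ⟨x, y, c, hxy, hs, -⟩)
    · rw [h]
      cases p <;> decide
    · rw [F.winner_eq_none hxy hs]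
      exact nofun
  · rintro s (h | ⟨x, y, c, hxy, hs, R, hk, -⟩) ht hw
    · rw [h] at hw
      cases hw
    have hk := hk ht
    rw [known, Bool.or_eq_true, List.any_eq_true] at hk
    rcases hk with hk | ⟨⟨q, r⟩, hq, hk⟩
    · obtain ⟨b, C', J, hb⟩ := R.exists_jump_of_winJump F hxy hk
      exact ⟨⟨b, C', !s.turn⟩, ⟨rfl, Or.inr (hs ▸ J)⟩, Or.inl (hb.winner_eq hm)⟩
    · obtain rfl : (x, y, c) = q := sameCfg_iff.1 hk
      have hr := List.all_eq_true.1 hL _ hq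
      simp only [Bool.and_eq_true, Bool.or_eq_true] at hr
      obtain ⟨⟨hr, hmove⟩, hsafe⟩ := hr
      have : ∃ t, MoveRel m n s t ∧ t.ball = (X + r.1, Y + r.2.1) ∧
          Represents m n X Y t.chaps r.2.2 := by
        rcases hmove with hmove | hmove
        · exact R.exists_move_of_canPlace F hs hmove
        · obtain ⟨C', J, R'⟩ := R.exists_jump_of_canJump F hxy hmove
          exact ⟨⟨_, C', !s.turn⟩, ⟨rfl, Or.inr (hs ▸ J)⟩, rfl, R'⟩
      obtain ⟨t, hst, htb, htR⟩ := this
      refine ⟨t, hst, Or.inr ⟨_, _, _, hr, htb, htR, fun h => ?_, fun _ => hsafe⟩⟩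
      rw [hst.1, ht] at h
      cases p <;> cases h
  · rintro s t (h | ⟨x, y, c, hxy, hs, R, -, hk⟩) ht hw hst
    · rw [h] at hw
      cases hw
    rcases R.movesSafe_move F hs hxy (hk ht) hst with ⟨x', y', c', h1, h2, h3, h4⟩ | h
    · refine Or.inr ⟨x', y', c', h1, h2, h3, fun _ => h4, fun h => ?_⟩
      rw [hst.1, ht] at h
      cases p <;> cases h
    · exact Or.inl (h.winner_eq hm)

theorem exists_frame {m n : ℤ} (h1 : n ≤ m - 2) (h2 : 10 ≤ n) : ∃ X Y, Frame m n X Y :=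
  ⟨n / 2 - 1, m - n / 2 - 5, by constructor <;> omega⟩

open Classical in
theorem exists_represents (m n X Y : ℤ) (c : ℕ) : ∃ C, Represents m n X Y C c := by
  refine ⟨(Finset.Icc 1 n ×ˢ Finset.Icc 1 m).filter fun q => ∀ a b : ℕ, inWin a b = true →
    q.1 = X + a → q.2 = Y + b → hasBit c (3 * b + a) = true, fun u v => ?_⟩
  simp only [Finset.mem_filter, Finset.mem_product, Finset.mem_Icc, OnBoard, and_assoc]

/-- **Corollary (Sarkar, Corollary 2).**  For all integers `m`, `n` with
`m - 2 ≥ n ≥ 10` there is a drawn position on the `m × n` Phutball board: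
a genuine position (ball and chaps on the board, ball not on a chap) from which
both players have drawing strategies. -/
theorem exists_drawn_position (m n : ℤ) (h1 : n ≤ m - 2) (h2 : 10 ≤ n) :
    ∃ s : PState, OnBoard m n s.ball ∧ (∀ p ∈ s.chaps, OnBoard m n p) ∧
      s.ball ∉ s.chaps ∧ Drawn m n s := by
  obtain ⟨X, Y, F⟩ := exists_frame h1 h2
  obtain ⟨C, R⟩ := exists_represents m n X Y startMask
  have hw : inWin 3 4 = true := by decide
  refine ⟨⟨(X + (3 : ℕ), Y + (4 : ℕ)), C, true⟩, F.onBoard hw, fun q hq => ((R q.1 q.2).1 hq).1,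
    fun h => ?_, SafeFor.drawsFrom F closed_alfredReplies ?_,
    SafeFor.drawsFrom F closed_bettyReplies ?_⟩
  · exact absurd ((R.mem_iff F hw).1 h) (by decide)
  · exact Or.inr ⟨3, 4, _, hw, rfl, R, fun _ => known_start, nofun⟩
  · exact Or.inr ⟨3, 4, _, hw, rfl, R, nofun, fun _ => movesSafe_start⟩
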